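/- Let d ≥ 1, let 1 < p ≤ 2, let 𝓜 be a compact subset of the d×d real symmetric matrices, and for each ε > 0 let 𝓤_ε := { R(I + εU + r(ε,U)) : R ∈ SO(d), U ∈ 𝓜 }, where r(ε,U) is a symmetric-matrix-valued remainder satisfying sup_{U ∈ 𝓜} ‖r(ε,U)‖/ε → 0 as ε → 0⁺. Suppose that c > 0 and that for each ε > 0 the function W_ε : ℝ^{d×d} → [0,∞] satisfies W_ε(F) ≥ c·g_p(dist(F, 𝓤_ε)) for every F, and suppose that for a symmetric matrix E the limit V(E) := lim_{ε→0⁺} (1/ε²)·W_ε(I + εE) exists in ℝ. Then V(E) ≥ (c/2)·dist²(E, 𝓜); in particular there exist constants C₁, C₂ > 0, independent of E, such that V(E) ≥ C₁‖E‖² − C₂. -/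

import Mathlib

open Matrix Filter Topology

noncomputable section

/-- Frobenius norm of a real `d × d` matrix. -/
def frob {d : ℕ} (F : Matrix (Fin d) (Fin d) ℝ) : ℝ :=
  Real.sqrt (∑ i, ∑ j, (F i j) ^ 2)

/-- Distance (w.r.t. the Frobenius norm) from a matrix to a set of matrices. -/
def fdist {d : ℕ} (F : Matrix (Fin d) (Fin d) ℝ)
    (S : Set (Matrix (Fin d) (Fin d) ℝ)) : ℝ :=
  sInf ((fun G => frob (F - G)) '' S)

/-- The special orthogonal group `SO(d)` as a set of matrices. -/
def SOd (d : ℕ) : Set (Matrix (Fin d) (Fin d) ℝ) :=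
  {R | R * Rᵀ = 1 ∧ R.det = 1}

/-- The function `g_p` from the paper. -/
def gp (p t : ℝ) : ℝ := if t ≤ 1 then t ^ 2 / 2 else t ^ p / p + (1 / 2 - 1 / p)

/-- The wells `𝓤_ε = { R (I + εU + r(ε,U)) : R ∈ SO(d), U ∈ 𝓜 }`. -/
def wells (d : ℕ) (M : Set (Matrix (Fin d) (Fin d) ℝ))
    (r : ℝ → Matrix (Fin d) (Fin d) ℝ → Matrix (Fin d) (Fin d) ℝ) (ε : ℝ) :
    Set (Matrix (Fin d) (Fin d) ℝ) :=
  {G | ∃ R ∈ SOd d, ∃ U ∈ M, G = R * (1 + ε • U + r ε U)}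

section Frobenius

attribute [local instance] Matrix.frobeniusNormedAddCommGroup Matrix.frobeniusNormedSpace

lemma frob_eq_norm {d : ℕ} (F : Matrix (Fin d) (Fin d) ℝ) : frob F = ‖F‖ := by
  simp [frob, Matrix.frobenius_norm_def, Real.sqrt_eq_rpow]

lemma frob_add_le {d : ℕ} (F G : Matrix (Fin d) (Fin d) ℝ) :
    frob (F + G) ≤ frob F + frob G := by
  simpa only [frob_eq_norm] using norm_add_le F G

lemma frob_sub_le {d : ℕ} (F G : Matrix (Fin d) (Fin d) ℝ) :
    frob (F - G) ≤ frob F + frob G := by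
  simpa only [frob_eq_norm] using norm_sub_le F G

lemma frob_smul {d : ℕ} (a : ℝ) (F : Matrix (Fin d) (Fin d) ℝ) :
    frob (a • F) = |a| * frob F := by
  simpa only [frob_eq_norm, Real.norm_eq_abs] using norm_smul a F

lemma frob_mul_le {d : ℕ} (F G : Matrix (Fin d) (Fin d) ℝ) :
    frob (F * G) ≤ frob F * frob G := by
  simpa only [frob_eq_norm] using Matrix.frobenius_norm_mul F G

lemma frob_transpose {d : ℕ} (F : Matrix (Fin d) (Fin d) ℝ) : frob Fᵀ = frob F := by
  simpa only [frob_eq_norm] using Matrix.frobenius_norm_transpose F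

end Frobenius

lemma frob_nonneg {d : ℕ} (F : Matrix (Fin d) (Fin d) ℝ) : 0 ≤ frob F := Real.sqrt_nonneg _

lemma frob_eq_sqrt_trace {d : ℕ} (F : Matrix (Fin d) (Fin d) ℝ) :
    frob F = Real.sqrt (Fᵀ * F).trace := by
  rw [frob, Finset.sum_comm]
  simp [Matrix.trace, Matrix.mul_apply, sq]

/-- Left multiplication by an orthogonal matrix preserves the Frobenius norm. -/
lemma frob_orthogonal_mul {d : ℕ} {R : Matrix (Fin d) (Fin d) ℝ} (hR : R * Rᵀ = 1)
    (F : Matrix (Fin d) (Fin d) ℝ) : frob (R * F) = frob F := by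
  have hR' : Rᵀ * R = 1 := mul_eq_one_comm.mp hR
  rw [frob_eq_sqrt_trace, frob_eq_sqrt_trace, Matrix.transpose_mul, Matrix.mul_assoc,
    ← Matrix.mul_assoc Rᵀ, hR', Matrix.one_mul]

lemma continuous_frob {d : ℕ} : Continuous (frob (d := d)) := by
  unfold frob
  fun_prop

lemma fdist_le {d : ℕ} {F G : Matrix (Fin d) (Fin d) ℝ} {S : Set (Matrix (Fin d) (Fin d) ℝ)}
    (hG : G ∈ S) : fdist F S ≤ frob (F - G) :=
  csInf_le ⟨0, by rintro _ ⟨H, -, rfl⟩; exact frob_nonneg _⟩ ⟨G, hG, rfl⟩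

lemma le_fdist {d : ℕ} {F : Matrix (Fin d) (Fin d) ℝ} {S : Set (Matrix (Fin d) (Fin d) ℝ)}
    (hS : S.Nonempty) {a : ℝ} (h : ∀ G ∈ S, a ≤ frob (F - G)) : a ≤ fdist F S :=
  le_csInf (hS.image _) (by rintro _ ⟨G, hG, rfl⟩; exact h G hG)

lemma fdist_nonneg {d : ℕ} (F : Matrix (Fin d) (Fin d) ℝ)
    (S : Set (Matrix (Fin d) (Fin d) ℝ)) : 0 ≤ fdist F S :=
  Real.sInf_nonneg (by rintro _ ⟨G, -, rfl⟩; exact frob_nonneg _)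

/-- An orthogonal `R` is close to the identity when `1 + P` and `R * (1 + Q)` are close. -/
lemma frob_orthogonal_sub_one_le {d : ℕ} {R : Matrix (Fin d) (Fin d) ℝ} (hR : R * Rᵀ = 1)
    (P Q : Matrix (Fin d) (Fin d) ℝ) :
    frob (R - 1) ≤ frob (1 + P - R * (1 + Q)) + frob P + frob Q := by
  have h : R - 1 = P - R * Q - (1 + P - R * (1 + Q)) := by noncomm_ring
  have h1 := frob_sub_le (P - R * Q) (1 + P - R * (1 + Q))
  have h2 := frob_sub_le P (R * Q)
  rw [frob_orthogonal_mul hR] at h2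
  rw [h]
  linarith

/-- Linearisation at the identity: the skew part of `R - 1` does not contribute to the symmetric
part of `1 + P - R * (1 + Q)`, and its symmetric part is quadratically small. -/
lemma frob_sub_le_of_orthogonal {d : ℕ} {R P Q : Matrix (Fin d) (Fin d) ℝ} (hR : R * Rᵀ = 1)
    (hP : P.IsSymm) (hQ : Q.IsSymm) :
    frob (P - Q) ≤ frob (1 + P - R * (1 + Q)) + frob (R - 1) ^ 2 / 2
      + frob (R - 1) * frob Q := by
  set N := 1 + P - R * (1 + Q) with hN
  set X := R - 1 with hX
  have hNt : Nᵀ = 1 + P - (1 + Q) * Rᵀ := by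
    simp [hN, hP.eq, hQ.eq]
  have hXX : X * Xᵀ = 1 - R - Rᵀ + 1 := by
    have : X * Xᵀ = R * Rᵀ - R - Rᵀ + 1 := by
      simp only [hX, Matrix.transpose_sub, Matrix.transpose_one]
      noncomm_ring
    rw [this, hR]
  have hXQt : (X * Q)ᵀ = Q * Rᵀ - Q := by
    simp [hX, hQ.eq, Matrix.mul_sub]
  have h2 : (2 : ℝ) • (P - Q) = N + Nᵀ - X * Xᵀ + (X * Q + (X * Q)ᵀ) := by
    rw [hNt, hXX, hXQt, hN, hX, two_smul]
    noncomm_ring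
  have e1 := frob_add_le (N + Nᵀ - X * Xᵀ) (X * Q + (X * Q)ᵀ)
  have e2 := frob_sub_le (N + Nᵀ) (X * Xᵀ)
  have e3 := frob_add_le N Nᵀ
  have e4 := frob_add_le (X * Q) (X * Q)ᵀ
  have e5 := frob_mul_le X Xᵀ
  have e6 := frob_mul_le X Q
  rw [← h2, frob_smul, abs_two] at e1
  rw [frob_transpose] at e3 e4 e5
  nlinarith

/-- The distance of `1 + ε • E` to the wells is asymptotically at least `ε * fdist E M`. -/
lemma eventually_mul_le_fdist_wells {d : ℕ} {M : Set (Matrix (Fin d) (Fin d) ℝ)}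
    (hMne : M.Nonempty) {m : ℝ} (hm : ∀ U ∈ M, frob U ≤ m) (hMsym : ∀ U ∈ M, U.IsSymm)
    {r : ℝ → Matrix (Fin d) (Fin d) ℝ → Matrix (Fin d) (Fin d) ℝ}
    (hrsym : ∀ ε > (0 : ℝ), ∀ U ∈ M, (r ε U).IsSymm)
    (hr : ∀ δ > (0 : ℝ), ∃ ε₀ > (0 : ℝ), ∀ ε : ℝ, 0 < ε → ε < ε₀ →
      ∀ U ∈ M, frob (r ε U) ≤ δ * ε)
    {E : Matrix (Fin d) (Fin d) ℝ} (hE : E.IsSymm) {s : ℝ} (hs : s < fdist E M) :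
    ∀ᶠ ε in 𝓝[>] (0 : ℝ), ε * s ≤ fdist (1 + ε • E) (wells d M r ε) := by
  set D := fdist E M with hD
  set δ := (D - s) / 2 with hδ
  have hδ0 : 0 < δ := by linarith
  have hm0 : 0 ≤ m := by
    obtain ⟨U, hU⟩ := hMne
    exact (frob_nonneg U).trans (hm U hU)
  have hD0 : 0 ≤ D := fdist_nonneg E M
  have hE0 := frob_nonneg E
  obtain ⟨ε₀, hε₀, hr'⟩ := hr δ hδ0
  set K := D + frob E + m + δ with hK
  have hK0 : 0 < K := by positivity
  have hsmall : ∀ᶠ ε in 𝓝[>] (0 : ℝ), ε * (K ^ 2 / 2 + K * (m + δ)) < δ := by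
    have : Tendsto (fun ε : ℝ => ε * (K ^ 2 / 2 + K * (m + δ))) (𝓝[>] 0) (𝓝 0) := by
      have h : Continuous fun ε : ℝ => ε * (K ^ 2 / 2 + K * (m + δ)) := by fun_prop
      simpa using (h.tendsto 0).mono_left nhdsWithin_le_nhds
    exact this.eventually_lt_const hδ0
  filter_upwards [hsmall, Ioo_mem_nhdsGT hε₀] with ε hε1 ⟨hε, hεlt⟩
  have h1 : (1 : Matrix (Fin d) (Fin d) ℝ) ∈ SOd d := by simp [SOd]
  obtain ⟨U₀, hU₀⟩ := hMne
  have hne : (wells d M r ε).Nonempty := ⟨_, 1, h1, U₀, hU₀, rfl⟩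
  refine le_fdist hne ?_
  rintro _ ⟨R, ⟨hR, -⟩, U, hU, rfl⟩
  have hrU := hr' ε hε hεlt U hU
  have hmU := hm U hU
  have hQs : (ε • U + r ε U).IsSymm := ((hMsym U hU).smul ε).add (hrsym ε hε U hU)
  have hQ : frob (ε • U + r ε U) ≤ ε * (m + δ) := by
    have := frob_add_le (ε • U) (r ε U)
    rw [frob_smul, abs_of_pos hε] at this
    nlinarith
  have hP : frob (ε • E) = ε * frob E := by rw [frob_smul, abs_of_pos hε]
  have hX := frob_orthogonal_sub_one_le hR (ε • E) (ε • U + r ε U)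
  have hmain := frob_sub_le_of_orthogonal hR (hE.smul ε) hQs
  rw [← add_assoc] at hX hmain
  have hdist : ε * (D - δ) ≤ frob (ε • E - (ε • U + r ε U)) := by
    have h3 := frob_add_le (ε • E - (ε • U + r ε U)) (r ε U)
    rw [show ε • E - (ε • U + r ε U) + r ε U = ε • (E - U) by rw [smul_sub]; abel,
      frob_smul, abs_of_pos hε] at h3
    have h4 : D ≤ frob (E - U) := fdist_le hU
    nlinarith
  rw [add_assoc 1] at hX hmain ⊢
  set n := frob (1 + ε • E - R * (1 + (ε • U + r ε U)))
  by_contra! hn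
  have hnD : n ≤ ε * D := by nlinarith
  have hk : frob (R - 1) ≤ ε * K := by rw [hK]; nlinarith
  have hk0 := frob_nonneg (R - 1)
  have hq1 : frob (R - 1) ^ 2 ≤ (ε * K) ^ 2 := by gcongr
  have hq2 : frob (R - 1) * frob (ε • U + r ε U) ≤ (ε * K) * (ε * (m + δ)) := by
    have := frob_nonneg (ε • U + r ε U)
    gcongr
  have hfin : ε * (ε * (K ^ 2 / 2 + K * (m + δ))) < ε * δ := by gcongr
  have : ε * s = ε * (D - δ) - ε * δ := by rw [hδ]; ring
  nlinarith

lemma eventually_fdist_wells_le_one {d : ℕ} {M : Set (Matrix (Fin d) (Fin d) ℝ)}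
    (hMne : M.Nonempty)
    {r : ℝ → Matrix (Fin d) (Fin d) ℝ → Matrix (Fin d) (Fin d) ℝ}
    (hr : ∀ δ > (0 : ℝ), ∃ ε₀ > (0 : ℝ), ∀ ε : ℝ, 0 < ε → ε < ε₀ →
      ∀ U ∈ M, frob (r ε U) ≤ δ * ε)
    (E : Matrix (Fin d) (Fin d) ℝ) :
    ∀ᶠ ε in 𝓝[>] (0 : ℝ), fdist (1 + ε • E) (wells d M r ε) ≤ 1 := by
  obtain ⟨U, hU⟩ := hMne
  obtain ⟨ε₀, hε₀, hr'⟩ := hr 1 one_pos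
  have hsmall : ∀ᶠ ε in 𝓝[>] (0 : ℝ), ε * (frob (E - U) + 1) < 1 := by
    have : Tendsto (fun ε : ℝ => ε * (frob (E - U) + 1)) (𝓝[>] 0) (𝓝 0) := by
      have h : Continuous fun ε : ℝ => ε * (frob (E - U) + 1) := by fun_prop
      simpa using (h.tendsto 0).mono_left nhdsWithin_le_nhds
    exact this.eventually_lt_const one_pos
  filter_upwards [hsmall, Ioo_mem_nhdsGT hε₀] with ε hε1 ⟨hε, hεlt⟩
  have h1 : (1 : Matrix (Fin d) (Fin d) ℝ) ∈ SOd d := by simp [SOd]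
  have hle : fdist (1 + ε • E) (wells d M r ε) ≤ _ := fdist_le ⟨1, h1, U, hU, rfl⟩
  have h2 := frob_sub_le (ε • (E - U)) (r ε U)
  rw [show ε • (E - U) - r ε U = 1 + ε • E - 1 * (1 + ε • U + r ε U) by
    rw [smul_sub, one_mul]; abel, frob_smul, abs_of_pos hε] at h2
  have := hr' ε hε hεlt U hU
  linarith

/-- if the energies `W_ε : ℝ^{d×d} → [0,∞]` satisfy
`W_ε(F) ≥ c g_p(dist(F,𝓤_ε))` and for each symmetric `E` the limit
`V(E) = lim_{ε→0⁺} (1/ε²) W_ε(I + εE)` exists in `ℝ` (i.e. is a finite extended real `v E`),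
then `V(E) ≥ (c/2) dist²(E,𝓜)`; in particular there are constants `C₁, C₂ > 0`, independent
of `E`, with `V(E) ≥ C₁‖E‖² − C₂`. -/
theorem V_lower_bound (d : ℕ) (hd : 1 ≤ d) (p : ℝ) (hp1 : 1 < p) (hp2 : p ≤ 2)
    (M : Set (Matrix (Fin d) (Fin d) ℝ)) (hMne : M.Nonempty)
    (hMcpt : IsCompact M) (hMsym : ∀ U ∈ M, U.IsSymm)
    (r : ℝ → Matrix (Fin d) (Fin d) ℝ → Matrix (Fin d) (Fin d) ℝ)
    (hrsym : ∀ ε > (0 : ℝ), ∀ U ∈ M, (r ε U).IsSymm)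
    (hr : ∀ δ > (0 : ℝ), ∃ ε₀ > (0 : ℝ), ∀ ε : ℝ, 0 < ε → ε < ε₀ →
      ∀ U ∈ M, frob (r ε U) ≤ δ * ε)
    (c : ℝ) (hc : 0 < c)
    (W : ℝ → Matrix (Fin d) (Fin d) ℝ → ENNReal)
    (hW : ∀ ε > (0 : ℝ), ∀ F : Matrix (Fin d) (Fin d) ℝ,
      ENNReal.ofReal (c * gp p (fdist F (wells d M r ε))) ≤ W ε F)
    (v : Matrix (Fin d) (Fin d) ℝ → ENNReal)
    (hv : ∀ E : Matrix (Fin d) (Fin d) ℝ, E.IsSymm →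
      Tendsto (fun ε : ℝ => ENNReal.ofReal (1 / ε ^ 2) * W ε (1 + ε • E))
        (𝓝[>] 0) (𝓝 (v E)))
    (hvfin : ∀ E : Matrix (Fin d) (Fin d) ℝ, E.IsSymm → v E ≠ ⊤) :
    (∀ E : Matrix (Fin d) (Fin d) ℝ, E.IsSymm →
      c / 2 * (fdist E M) ^ 2 ≤ (v E).toReal) ∧
    ∃ C₁ > (0 : ℝ), ∃ C₂ > (0 : ℝ), ∀ E : Matrix (Fin d) (Fin d) ℝ, E.IsSymm →
      C₁ * (frob E) ^ 2 - C₂ ≤ (v E).toReal := by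
  obtain ⟨m, hm⟩ := hMcpt.exists_bound_of_continuousOn (continuous_frob (d := d)).continuousOn
  replace hm : ∀ U ∈ M, frob U ≤ m := fun U hU => (le_abs_self _).trans (hm U hU)
  have hquad : ∀ E : Matrix (Fin d) (Fin d) ℝ, E.IsSymm →
      c / 2 * (fdist E M) ^ 2 ≤ (v E).toReal := by
    intro E hE
    obtain hD | hD := (fdist_nonneg E M).eq_or_lt
    · simp [← hD]
    have hlt : ∀ s ∈ Set.Ioo 0 (fdist E M), c / 2 * s ^ 2 ≤ (v E).toReal := by
      rintro s ⟨hs0, hs⟩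
      rw [← ENNReal.ofReal_le_iff_le_toReal (hvfin E hE)]
      refine ge_of_tendsto (hv E hE) ?_
      filter_upwards [eventually_mul_le_fdist_wells hMne hm hMsym hrsym hr hE hs,
        eventually_fdist_wells_le_one hMne hr E, self_mem_nhdsWithin] with ε h1 h2 hε
      replace hε : 0 < ε := hε
      refine le_trans ?_ (mul_le_mul_right (hW ε hε (1 + ε • E)) _)
      rw [← ENNReal.ofReal_mul (by positivity), gp, if_pos h2]
      apply ENNReal.ofReal_le_ofReal
      have h3 : (ε * s) ^ 2 ≤ fdist (1 + ε • E) (wells d M r ε) ^ 2 := by gcongr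
      rw [one_div_mul_eq_div, le_div_iff₀ (by positivity)]
      nlinarith
    have hcont : Tendsto (fun s : ℝ => c / 2 * s ^ 2) (𝓝[<] fdist E M)
        (𝓝 (c / 2 * fdist E M ^ 2)) := by
      have h : Continuous fun s : ℝ => c / 2 * s ^ 2 := by fun_prop
      exact (h.tendsto _).mono_left nhdsWithin_le_nhds
    refine le_of_tendsto hcont ?_
    filter_upwards [Ioo_mem_nhdsLT hD] with s hs using hlt s hs
  refine ⟨hquad, c / 4, by positivity, c / 2 * m ^ 2 + 1, by positivity, fun E hE => ?_⟩
  have hdist : frob E - m ≤ fdist E M := le_fdist hMne fun U hU => by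
    have h1 := frob_add_le (E - U) U
    rw [sub_add_cancel] at h1
    linarith [hm U hU]
  have hsq : frob E ^ 2 ≤ (fdist E M + m) ^ 2 :=
    pow_le_pow_left₀ (frob_nonneg E) (by linarith) 2
  have h2 : frob E ^ 2 ≤ 2 * fdist E M ^ 2 + 2 * m ^ 2 := by
    nlinarith [sq_nonneg (fdist E M - m)]
  nlinarith [hquad E hE]
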